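/- arXiv:2409.04352 — 3 statements merged into one kernel-verified Lean document; each statement's English description precedes it below -/
import Mathlib

section
/- Fix K ≥ 1, N ≥ 1, β with 0 < β < 1. Let ω_0(k) > 0 with Σ_{k=1}^K ω_0(k) = 1, let r_n(k) ∈ [0,1] for n = 0,…,N−1 and k ∈ {1,…,K}, define π_n(k) = ω_n(k)/Σ_{j=1}^K ω_n(j) and ω_{n+1}(k) = ω_n(k)·β^{r_n(k)}, and set L_n = Σ_{k=1}^K π_n(k)·r_n(k). Then Σ_{k=1}^K ω_N(k) ≤ Π_{n=0}^{N−1} (1 − (1 − β)·L_n). -/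
/-- One multiplicative-weights step shrinks the total weight by at least the factor
`1 - (1 - β) * L`, where `L` is the loss of the normalized mixture. -/
lemma sum_mul_rpow_le_sum_mul {ι : Type*} [Fintype ι] {β : ℝ} (hβ : 0 ≤ β) {w r : ι → ℝ}
    (hw : ∀ k, 0 ≤ w k) (hw0 : ∑ k, w k ≠ 0) (hr0 : ∀ k, 0 ≤ r k) (hr1 : ∀ k, r k ≤ 1) :
    ∑ k, w k * β ^ r k ≤ (∑ k, w k) * (1 - (1 - β) * ∑ k, w k / (∑ j, w j) * r k) := by
  have bernoulli (k : ι) : β ^ r k ≤ 1 - (1 - β) * r k := by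
    have h := rpow_one_add_le_one_add_mul_self (s := β - 1) (by linarith) (hr0 k) (hr1 k)
    rw [add_sub_cancel] at h
    linarith
  calc ∑ k, w k * β ^ r k
      ≤ ∑ k, w k * (1 - (1 - β) * r k) :=
        Finset.sum_le_sum fun k _ => mul_le_mul_of_nonneg_left (bernoulli k) (hw k)
    _ = ∑ k, w k - (1 - β) * ∑ k, w k * r k := by
        rw [Finset.mul_sum, ← Finset.sum_sub_distrib]
        exact Finset.sum_congr rfl fun k _ => by ring
    _ = (∑ k, w k) * (1 - (1 - β) * ∑ k, w k / (∑ j, w j) * r k) := by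
        simp_rw [div_mul_eq_mul_div, ← Finset.sum_div]
        field_simp

theorem weight_sum_prod_bound (K N : ℕ) (hK : 1 ≤ K) (hN : 1 ≤ N)
    (β : ℝ) (hβ0 : 0 < β) (hβ1 : β < 1)
    (ω : ℕ → Fin K → ℝ) (r : ℕ → Fin K → ℝ) (π : ℕ → Fin K → ℝ) (L : ℕ → ℝ)
    (hω0 : ∀ k, 0 < ω 0 k) (hω0sum : ∑ k, ω 0 k = 1)
    (hr0 : ∀ n < N, ∀ k, 0 ≤ r n k) (hr1 : ∀ n < N, ∀ k, r n k ≤ 1)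
    (hπ : ∀ n k, π n k = ω n k / ∑ j, ω n j)
    (hrec : ∀ n < N, ∀ k, ω (n + 1) k = ω n k * β ^ (r n k))
    (hL : ∀ n, L n = ∑ k, π n k * r n k) :
    ∑ k, ω N k ≤ ∏ n ∈ Finset.range N, (1 - (1 - β) * L n) := by
  have hne : (Finset.univ : Finset (Fin K)).Nonempty := ⟨⟨0, hK⟩, Finset.mem_univ _⟩
  have hpos : ∀ n ≤ N, ∀ k, 0 < ω n k := by
    intro n
    induction n with
    | zero => exact fun _ => hω0
    | succ n ih =>
      intro hn k
      rw [hrec n hn k]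
      exact mul_pos (ih (by omega) k) (Real.rpow_pos_of_pos hβ0 _)
  have hsum (n : ℕ) (hn : n ≤ N) : 0 < ∑ k, ω n k :=
    Finset.sum_pos (fun k _ => hpos n hn k) hne
  have hstep (n : ℕ) (hn : n < N) :
      ∑ k, ω (n + 1) k ≤ (∑ k, ω n k) * (1 - (1 - β) * L n) := by
    simp_rw [hrec n hn, hL, hπ]
    exact sum_mul_rpow_le_sum_mul hβ0.le (fun k => (hpos n hn.le k).le) (hsum n hn.le).ne'
      (hr0 n hn) (hr1 n hn)
  have hbound : ∀ n ≤ N, ∑ k, ω n k ≤ ∏ i ∈ Finset.range n, (1 - (1 - β) * L i) := by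
    intro n
    induction n with
    | zero => simp [hω0sum]
    | succ n ih =>
      intro hn
      have hfactor : 0 < 1 - (1 - β) * L n :=
        pos_of_mul_pos_right ((hsum (n + 1) hn).trans_le (hstep n hn)) (hsum n (by omega)).le
      rw [Finset.prod_range_succ]
      exact (hstep n hn).trans (mul_le_mul_of_nonneg_right (ih (by omega)) hfactor.le)
  exact hbound N le_rfl
end

section
/- Under the same setup (K ≥ 1, N ≥ 1, 0 < β < 1, initial weights ω_0(k) > 0 summing to one, risks r_n(k) ∈ [0,1], π_n(k) = ω_n(k)/Σ_j ω_n(j), ω_{n+1}(k) = ω_n(k)·β^{r_n(k)}, mixture losses L_n = Σ_k π_n(k) r_n(k)), the final weight sum satisfies Σ_{k=1}^K ω_N(k) ≤ exp( −(1 − β)·Σ_{n=0}^{N−1} L_n ). -/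
theorem rpow_le_one_sub_mul {β x : ℝ} (hβ : 0 ≤ β) (hx0 : 0 ≤ x) (hx1 : x ≤ 1) :
    β ^ x ≤ 1 - (1 - β) * x := by
  have h := rpow_one_add_le_one_add_mul_self (s := β - 1) (by linarith) hx0 hx1
  rw [add_sub_cancel] at h
  linarith

/-- One multiplicative-weights update shrinks the total weight by at least the factor
`exp (-(1 - β) * ℓ)`, where `ℓ` is the loss of the normalized mixture. -/
theorem sum_mul_rpow_le_sum_mul_exp {ι : Type*} [Fintype ι] {β : ℝ} (hβ : 0 ≤ β)
    {w x : ι → ℝ} (hw : ∀ k, 0 ≤ w k) (hx0 : ∀ k, 0 ≤ x k) (hx1 : ∀ k, x k ≤ 1)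
    (hsum : 0 < ∑ k, w k) :
    ∑ k, w k * β ^ x k ≤
      (∑ k, w k) * Real.exp (-(1 - β) * ∑ k, w k / (∑ j, w j) * x k) := by
  have hmix : (∑ k, w k) * ∑ k, w k / (∑ j, w j) * x k = ∑ k, w k * x k := by
    rw [Finset.mul_sum]
    refine Finset.sum_congr rfl fun k _ => ?_
    field_simp
  calc ∑ k, w k * β ^ x k
      ≤ ∑ k, w k * (1 - (1 - β) * x k) := Finset.sum_le_sum fun k _ =>
        mul_le_mul_of_nonneg_left (rpow_le_one_sub_mul hβ (hx0 k) (hx1 k)) (hw k)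
    _ = (∑ k, w k) - (1 - β) * ∑ k, w k * x k := by
        rw [Finset.mul_sum, ← Finset.sum_sub_distrib]
        exact Finset.sum_congr rfl fun k _ => by ring
    _ = (∑ k, w k) * (-(1 - β) * (∑ k, w k / (∑ j, w j) * x k) + 1) := by
        rw [← hmix]; ring
    _ ≤ _ := mul_le_mul_of_nonneg_left (Real.add_one_le_exp _) hsum.le

theorem weight_sum_exp_bound (K N : ℕ) (hK : 1 ≤ K) (hN : 1 ≤ N)
    (β : ℝ) (hβ0 : 0 < β) (hβ1 : β < 1)
    (ω : ℕ → Fin K → ℝ) (r : ℕ → Fin K → ℝ) (π : ℕ → Fin K → ℝ) (L : ℕ → ℝ)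
    (hω0 : ∀ k, 0 < ω 0 k) (hω0sum : ∑ k, ω 0 k = 1)
    (hr0 : ∀ n < N, ∀ k, 0 ≤ r n k) (hr1 : ∀ n < N, ∀ k, r n k ≤ 1)
    (hπ : ∀ n k, π n k = ω n k / ∑ j, ω n j)
    (hrec : ∀ n < N, ∀ k, ω (n + 1) k = ω n k * β ^ (r n k))
    (hL : ∀ n, L n = ∑ k, π n k * r n k) :
    ∑ k, ω N k ≤ Real.exp (-(1 - β) * ∑ n ∈ Finset.range N, L n) := by
  have : Nonempty (Fin K) := ⟨⟨0, hK⟩⟩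
  have hpos : ∀ n ≤ N, ∀ k, 0 < ω n k := by
    intro n
    induction n with
    | zero => exact fun _ => hω0
    | succ n ih =>
      intro hn k
      rw [hrec n hn k]
      exact mul_pos (ih (Nat.le_of_succ_le hn) k) (Real.rpow_pos_of_pos hβ0 _)
  have hbound : ∀ n ≤ N,
      ∑ k, ω n k ≤ Real.exp (-(1 - β) * ∑ m ∈ Finset.range n, L m) := by
    intro n
    induction n with
    | zero => simp [hω0sum]
    | succ n ih =>
      intro hn
      have hposn := hpos n (Nat.le_of_succ_le hn)
      have hstep := sum_mul_rpow_le_sum_mul_exp hβ0.le (fun k => (hposn k).le)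
        (hr0 n hn) (hr1 n hn)
        (Finset.sum_pos (fun k _ => hposn k) Finset.univ_nonempty)
      simp only [← hrec n hn, ← hπ, ← hL] at hstep
      rw [Finset.sum_range_succ, mul_add, Real.exp_add]
      exact hstep.trans
        (mul_le_mul_of_nonneg_right (ih (Nat.le_of_succ_le hn)) (Real.exp_pos _).le)
  exact hbound N le_rfl
end

section
/- (Proposition 1) Fix K ≥ 1, N ≥ 1, and β with 0 < β < 1. Let ω_0(k) > 0 for k ∈ {1,…,K} with Σ_{k=1}^K ω_0(k) = 1; let r_n(k) ∈ [0,1] for n = 0,…,N−1 and all k; define π_n(k) = ω_n(k)/Σ_{j=1}^K ω_n(j) and ω_{n+1}(k) = ω_n(k)·β^{r_n(k)}. Then the total overall mixture loss L = Σ_{n=0}^{N−1} Σ_{k=1}^K π_n(k)·r_n(k) satisfies L ≤ −(1/(1 − β))·log( Σ_{k=1}^K ω_N(k) ). -/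
/-- One multiplicative update decreases the logarithm of the total weight by at least
`1 - β` times the mixture loss. -/
theorem log_sum_mul_rpow_le {ι : Type*} [Fintype ι] [Nonempty ι] {β : ℝ} (hβ0 : 0 < β)
    {w r : ι → ℝ} (hw : ∀ k, 0 < w k) (hr0 : ∀ k, 0 ≤ r k) (hr1 : ∀ k, r k ≤ 1) :
    Real.log (∑ k, w k * β ^ r k) ≤
      Real.log (∑ k, w k) - (1 - β) * ∑ k, w k / (∑ j, w j) * r k := by
  have hS : 0 < ∑ k, w k := Finset.sum_pos (fun k _ => hw k) Finset.univ_nonempty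
  have hS' : 0 < ∑ k, w k * β ^ r k :=
    Finset.sum_pos (fun k _ => mul_pos (hw k) (Real.rpow_pos_of_pos hβ0 _)) Finset.univ_nonempty
  have hloss : ∑ k, w k / (∑ j, w j) * r k = (∑ k, w k * r k) / ∑ k, w k := by
    rw [Finset.sum_div]
    exact Finset.sum_congr rfl fun k _ => by ring
  have hle : ∑ k, w k * β ^ r k ≤ ∑ k, w k - (1 - β) * ∑ k, w k * r k := by
    rw [Finset.mul_sum, ← Finset.sum_sub_distrib]
    refine Finset.sum_le_sum fun k _ => ?_
    have hbern : β ^ r k ≤ 1 + r k * (β - 1) := by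
      simpa using rpow_one_add_le_one_add_mul_self (s := β - 1) (by linarith) (hr0 k) (hr1 k)
    calc w k * β ^ r k ≤ w k * (1 + r k * (β - 1)) := mul_le_mul_of_nonneg_left hbern (hw k).le
      _ = w k - (1 - β) * (w k * r k) := by ring
  have hlog := Real.log_le_sub_one_of_pos (div_pos hS' hS)
  rw [Real.log_div hS'.ne' hS.ne'] at hlog
  have hdiv := div_le_div_of_nonneg_right hle hS.le
  rw [sub_div, div_self hS.ne', mul_div_assoc] at hdiv
  rw [hloss]
  linarith

theorem total_mixture_loss_bound (K N : ℕ) (hK : 1 ≤ K) (hN : 1 ≤ N)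
    (β : ℝ) (hβ0 : 0 < β) (hβ1 : β < 1)
    (ω : ℕ → Fin K → ℝ) (r : ℕ → Fin K → ℝ) (π : ℕ → Fin K → ℝ)
    (hω0 : ∀ k, 0 < ω 0 k) (hω0sum : ∑ k, ω 0 k = 1)
    (hr0 : ∀ n < N, ∀ k, 0 ≤ r n k) (hr1 : ∀ n < N, ∀ k, r n k ≤ 1)
    (hπ : ∀ n k, π n k = ω n k / ∑ j, ω n j)
    (hrec : ∀ n < N, ∀ k, ω (n + 1) k = ω n k * β ^ (r n k)) :
    ∑ n ∈ Finset.range N, ∑ k, π n k * r n k ≤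
      -(1 / (1 - β)) * Real.log (∑ k, ω N k) := by
  have : Nonempty (Fin K) := ⟨⟨0, hK⟩⟩
  have hpotential : ∀ n ≤ N, (∀ k, 0 < ω n k) ∧
      (1 - β) * ∑ i ∈ Finset.range n, ∑ k, π i k * r i k ≤ -Real.log (∑ k, ω n k) := by
    intro n
    induction n with
    | zero => exact fun _ => ⟨hω0, by simp [hω0sum]⟩
    | succ n ih =>
      intro hn
      obtain ⟨hpos, hsum⟩ := ih (by omega)
      refine ⟨fun k => ?_, ?_⟩
      · rw [hrec n hn k]
        exact mul_pos (hpos k) (Real.rpow_pos_of_pos hβ0 _)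
      · have hstep := log_sum_mul_rpow_le hβ0 hpos (hr0 n hn) (hr1 n hn)
        simp only [← hπ, ← hrec n hn] at hstep
        rw [Finset.sum_range_succ, mul_add]
        linarith
  have hbound := (hpotential N le_rfl).2
  rw [neg_mul, one_div_mul_eq_div, ← neg_div, le_div_iff₀' (sub_pos.2 hβ1)]
  exact hbound
end
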